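/- Let β ∈ (0,1). The Mittag-Leffler survival function decays as a power law with index β: lim_{t→∞} t^β · E_β(-t^β) = 1/Γ(1-β). -/

import Mathlib

open MeasureTheory Set Filter

/-- The two-parameter Mittag-Leffler function `E_{γ,δ}(z) = ∑ zⁿ / Γ(nγ + δ)`. -/
noncomputable def ML2 (γ δ z : ℝ) : ℝ := ∑' n : ℕ, z ^ n / Real.Gamma (n * γ + δ)

/-- The one-parameter Mittag-Leffler function `E_β(z) = E_{β,1}(z)`. -/
noncomputable def ML (β z : ℝ) : ℝ := ML2 β 1 z

/-- The Mittag-Leffler density `f_β(t) = t^{β-1} E_{β,β}(-t^β)`. -/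
noncomputable def fML (β t : ℝ) : ℝ := t ^ (β - 1) * ML2 β β (-(t ^ β))

/-- The spectral kernel `K_β(θ)`. -/
noncomputable def Kspec (β θ : ℝ) : ℝ :=
  (1 / Real.pi) * (θ ^ (β - 1) * Real.sin (β * Real.pi)) /
    (θ ^ (2 * β) + 2 * θ ^ β * Real.cos (β * Real.pi) + 1)

open Topology

lemma beta_val {a b t : ℝ} (ha : 0 < a) (hb : 0 < b) (ht : 0 < t) :
    ∫ s in (0:ℝ)..t, s ^ (a-1) * (t-s)^(b-1)
      = t ^ (a+b-1) * (Real.Gamma a * Real.Gamma b / Real.Gamma (a+b)) := by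
  have h := Complex.betaIntegral_scaled a b ht
  rw [Complex.betaIntegral_eq_Gamma_mul_div _ _ (by simpa) (by simpa)] at h
  have h2 : ∫ s in (0:ℝ)..t, (s:ℂ) ^ ((a:ℂ)-1) * ((t:ℂ)-s)^((b:ℂ)-1)
      = ((∫ s in (0:ℝ)..t, s ^ (a-1) * (t-s)^(b-1) : ℝ) : ℂ) := by
    rw [← intervalIntegral.integral_ofReal]
    apply intervalIntegral.integral_congr
    intro s hs
    rw [uIcc_of_le ht.le] at hs
    simp only
    rw [Complex.ofReal_mul, Complex.ofReal_cpow hs.1, Complex.ofReal_cpow (by linarith [hs.2])]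
    push_cast; rfl
  rw [h2, Complex.Gamma_ofReal, Complex.Gamma_ofReal, ← Complex.ofReal_add, Complex.Gamma_ofReal,
    ← Complex.ofReal_one, ← Complex.ofReal_sub, ← Complex.ofReal_cpow ht.le] at h
  exact_mod_cast h

lemma beta_int {a b t : ℝ} (ha : 0 < a) (hb : 0 < b) (ht : 0 < t) :
    IntervalIntegrable (fun s => s ^ (a-1) * (t-s)^(b-1)) volume 0 t := by
  by_contra h
  have h1 := beta_val ha hb ht
  rw [intervalIntegral.integral_undef h] at h1
  have := Real.Gamma_pos_of_pos ha
  have := Real.Gamma_pos_of_pos hb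
  have := Real.Gamma_pos_of_pos (add_pos ha hb)
  have : 0 < t ^ (a+b-1) * (Real.Gamma a * Real.Gamma b / Real.Gamma (a+b)) := by positivity
  linarith

lemma gamma_ratio {β x : ℝ} (h0 : 0 < β) (h1 : β < 1) (hx : 0 < x + β - 1) :
    Real.Gamma x * (x + β - 1) ^ β ≤ Real.Gamma (x + β) := by
  have h := Real.Gamma_mul_add_mul_le_rpow_Gamma_mul_rpow_Gamma (s := x + β - 1) (t := x + β)
    (a := β) (b := 1 - β) hx (by linarith) h0 (by linarith) (by ring)
  rw [show β * (x + β - 1) + (1 - β) * (x + β) = x by ring] at h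
  have hg := Real.Gamma_pos_of_pos hx
  have e : Real.Gamma (x + β) = (x+β-1) * Real.Gamma (x+β-1) := by
    rw [← Real.Gamma_add_one hx.ne']; ring_nf
  have hp : 0 < Real.Gamma (x+β) := Real.Gamma_pos_of_pos (by linarith)
  calc _ ≤ (Real.Gamma (x+β-1) ^ β * Real.Gamma (x+β)^(1-β)) * (x+β-1)^β := by gcongr
    _ = ((x+β-1) * Real.Gamma (x+β-1))^β * Real.Gamma (x+β)^(1-β) := by
      rw [Real.mul_rpow hx.le hg.le]; ring
    _ = _ := by
      rw [← e, ← Real.rpow_add hp]; simp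

noncomputable def cML (β δ : ℝ) (n : ℕ) : ℝ := 1 / Real.Gamma (n * β + δ)

lemma cML_pos {β δ : ℝ} (h0 : 0 < β) (hδ : 0 < δ) (n : ℕ) : 0 < cML β δ n := by
  have := Real.Gamma_pos_of_pos (show 0 < n * β + δ by positivity)
  unfold cML; positivity

lemma cML_ratio {β δ : ℝ} (h0 : 0 < β) (h1 : β < 1) (hδ : 0 < δ) :
    Tendsto (fun n => ‖cML β δ (n+1)‖ / ‖cML β δ n‖) atTop (𝓝 0) := by
  have hl : Tendsto (fun n : ℕ => (n * β + δ + β - 1)) atTop atTop := by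
    have : Tendsto (fun n : ℕ => (n * β + (δ + β - 1))) atTop atTop :=
      tendsto_atTop_add_const_right _ _ (tendsto_natCast_atTop_atTop.atTop_mul_const h0)
    refine this.congr fun n => by ring
  have h2 : Tendsto (fun n : ℕ => ((n * β + δ + β - 1) ^ β)⁻¹) atTop (𝓝 0) :=
    ((tendsto_rpow_atTop h0).comp hl).inv_tendsto_atTop
  refine tendsto_of_tendsto_of_tendsto_of_le_of_le' tendsto_const_nhds h2
    (Eventually.of_forall fun n => by positivity) ?_
  filter_upwards [hl.eventually_gt_atTop 0] with n hn
  have h := gamma_ratio h0 h1 hn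
  have a1 := Real.Gamma_pos_of_pos (show 0 < n * β + δ by positivity)
  have a2 := Real.Gamma_pos_of_pos (show 0 < n * β + δ + β by positivity)
  rw [Real.norm_of_nonneg (cML_pos h0 hδ _).le, Real.norm_of_nonneg (cML_pos h0 hδ _).le]
  have e : ((n+1 : ℕ) : ℝ) * β + δ = n * β + δ + β := by push_cast; ring
  unfold cML
  rw [e]
  have : 0 < (n * β + δ + β - 1) ^ β := by positivity
  rw [div_div_div_cancel_left' _ _ one_ne_zero, inv_eq_one_div, div_le_div_iff₀ a2 this]
  linarith

lemma cML_radius {β δ : ℝ} (h0 : 0 < β) (h1 : β < 1) (hδ : 0 < δ) :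
    (FormalMultilinearSeries.ofScalars ℝ (cML β δ)).radius = ⊤ := by
  apply FormalMultilinearSeries.ofScalars_radius_eq_top_of_tendsto
  · exact Eventually.of_forall fun n => (cML_pos h0 hδ n).ne'
  · exact cML_ratio h0 h1 hδ

lemma ML2_eq (β δ : ℝ) :
    ML2 β δ = (FormalMultilinearSeries.ofScalars ℝ (cML β δ)).sum := by
  funext z
  have := FormalMultilinearSeries.ofScalars_sum_eq (cML β δ) z
  unfold FormalMultilinearSeries.ofScalarsSum at this
  rw [this]
  unfold ML2 cML
  congr 1; funext n; simp; ring

lemma ML2_diff {β δ : ℝ} (h0 : 0 < β) (h1 : β < 1) (hδ : 0 < δ) : Differentiable ℝ (ML2 β δ) := by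
  have h := (FormalMultilinearSeries.ofScalars ℝ (cML β δ)).hasFPowerSeriesOnBall
    (by rw [cML_radius h0 h1 hδ]; simp)
  rw [← ML2_eq, cML_radius h0 h1 hδ] at h
  have := h.differentiableOn
  intro z
  exact (this z (by simp)).differentiableAt (by simp)

lemma ML2_summable {β δ : ℝ} (h0 : 0 < β) (h1 : β < 1) (hδ : 0 < δ) (z : ℝ) :
    Summable (fun n : ℕ => ‖z ^ n / Real.Gamma (n * β + δ)‖) := by
  have := (FormalMultilinearSeries.ofScalars ℝ (cML β δ)).summable_norm_apply (x := z)
    (by rw [cML_radius h0 h1 hδ]; simp)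
  refine this.congr fun n => ?_
  rw [FormalMultilinearSeries.ofScalars_apply_eq]
  unfold cML
  congr 1; simp; ring

lemma ML2_rec {β δ : ℝ} (h0 : 0 < β) (h1 : β < 1) (hδ : 0 < δ) (z : ℝ) :
    ML2 β δ z = 1 / Real.Gamma δ + z * ML2 β (δ+β) z := by
  unfold ML2
  rw [(ML2_summable h0 h1 hδ z).of_norm.tsum_eq_zero_add, ← tsum_mul_left]
  congr 1
  · simp
  · congr 1; funext n; push_cast
    rw [show ((n:ℝ)+1) * β + δ = n * β + (δ + β) by ring]; ring

/-- `e_δ(t) = t^{δ-1} E_{β,δ}(-t^β)`. -/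
noncomputable def eML (β δ t : ℝ) : ℝ := t ^ (δ - 1) * ML2 β δ (-(t ^ β))

lemma eML_rec {β δ t : ℝ} (h0 : 0 < β) (h1 : β < 1) (hδ : 0 < δ) (ht : 0 < t) :
    eML β δ t = t ^ (δ-1) / Real.Gamma δ - eML β (δ+β) t := by
  unfold eML
  rw [ML2_rec h0 h1 hδ, show δ + β - 1 = (δ - 1) + β by ring, Real.rpow_add ht]
  ring

lemma eML_diffAt {β δ t : ℝ} (h0 : 0 < β) (h1 : β < 1) (hδ : 0 < δ) (ht : 0 < t) :
    DifferentiableAt ℝ (eML β δ) t := by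
  unfold eML
  have := (ML2_diff h0 h1 hδ (-(t ^ β)))
  refine DifferentiableAt.mul (Real.differentiableAt_rpow_const_of_ne _ ht.ne') ?_
  exact DifferentiableAt.comp (f := fun t : ℝ => -(t ^ β)) t this
    (Real.differentiableAt_rpow_const_of_ne _ ht.ne').neg

lemma eML_int {β δ α t : ℝ} (h0 : 0 < β) (h1 : β < 1) (hδ : 0 < δ) (hα : 0 < α) (ht : 0 < t) :
    IntervalIntegrable (fun s => eML β δ s * (t-s)^(α-1)) volume 0 t := by
  have h := (beta_int hδ hα ht).mul_continuousOn (g := fun s => ML2 β δ (-(s^β)))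
    (((ML2_diff h0 h1 hδ).continuous.comp (by
      exact (Real.continuous_rpow_const h0.le).neg)).continuousOn)
  refine h.congr fun s _ => ?_
  simp only [eML]; ring

lemma eML_conv {β δ α t : ℝ} (h0 : 0 < β) (h1 : β < 1) (hδ : 0 < δ) (hα : 0 < α) (ht : 0 < t) :
    ∫ s in (0:ℝ)..t, eML β δ s * (t-s)^(α-1) = Real.Gamma α * eML β (δ+α) t := by
  let F : ℕ → ℝ → ℝ := fun n s =>
    ((-1)^n / Real.Gamma (n*β+δ)) * (s ^ ((n*β+δ)-1) * (t-s)^(α-1))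
  have hpos : ∀ n : ℕ, 0 < n * β + δ := fun n => by positivity
  have hG : ∀ n : ℕ, 0 < Real.Gamma (n*β+δ) := fun n => Real.Gamma_pos_of_pos (hpos n)
  have hG2 : ∀ n : ℕ, 0 < Real.Gamma (n*β+δ+α) := fun n => 
    Real.Gamma_pos_of_pos (by have := hpos n; positivity)
  have hga := Real.Gamma_pos_of_pos hα
  have hpw : ∀ n : ℕ, t ^ (n*β+δ+α-1) = t ^ (δ+α-1) * (t^β)^n := fun n => by
    rw [← Real.rpow_natCast, ← Real.rpow_mul ht.le, ← Real.rpow_add ht]; ring_nf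
  have hFi : ∀ n, IntegrableOn (F n) (Ioc 0 t) volume := fun n =>
    ((intervalIntegrable_iff_integrableOn_Ioc_of_le ht.le).1 (beta_int (hpos n) hα ht)).const_mul _
  have hFv : ∀ n, ∫ s in Ioc 0 t, F n s = 
      (Real.Gamma α * t ^ (δ+α-1)) * ((-(t^β))^n / Real.Gamma (n*β+(δ+α))) := fun n => by
    rw [← intervalIntegral.integral_of_le ht.le, intervalIntegral.integral_const_mul,
      beta_val (hpos n) hα ht, hpw, neg_pow (t^β), ← add_assoc]
    have := (hG n).ne'
    have := (hG2 n).ne'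
    field_simp
  have hFn : ∀ n, ∫ s in Ioc 0 t, ‖F n s‖ = 
      (Real.Gamma α * t ^ (δ+α-1)) * ‖((-(t^β))^n / Real.Gamma (n*β+(δ+α)))‖ := fun n => by
    have : ∫ s in Ioc 0 t, ‖F n s‖ = ∫ s in Ioc 0 t, 
        (1 / Real.Gamma (n*β+δ)) * (s ^ ((n*β+δ)-1) * (t-s)^(α-1)) := by
      refine setIntegral_congr_fun measurableSet_Ioc fun s hs => ?_
      have h3 : 0 ≤ (s ^ ((n*β+δ)-1) * (t-s)^(α-1)) :=
        mul_nonneg (Real.rpow_nonneg hs.1.le _) (Real.rpow_nonneg (by linarith [hs.2]) _)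
      simp only [F]
      rw [norm_mul, norm_div, norm_pow, norm_neg, norm_one, one_pow,
        Real.norm_of_nonneg (hG n).le, Real.norm_of_nonneg h3]
    rw [this, ← intervalIntegral.integral_of_le ht.le, intervalIntegral.integral_const_mul,
      beta_val (hpos n) hα ht, hpw, norm_div, norm_pow, norm_neg, ← add_assoc,
      Real.norm_of_nonneg (hG2 n).le, Real.norm_of_nonneg (Real.rpow_nonneg ht.le _)]
    have := (hG n).ne'
    have := (hG2 n).ne'
    field_simp
  have hs := hasSum_integral_of_summable_integral_norm hFi (by
    simp_rw [hFn]
    exact (ML2_summable h0 h1 (by positivity) _).mul_left _)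
  have hR := hs.tsum_eq
  simp_rw [hFv] at hR
  rw [tsum_mul_left] at hR
  rw [intervalIntegral.integral_of_le ht.le]
  trans ∫ s in Ioc 0 t, ∑' n, F n s
  · refine setIntegral_congr_fun measurableSet_Ioc fun s hs => ?_
    simp only [eML, ML2, F]
    rw [← tsum_mul_left, ← tsum_mul_right]
    congr 1; funext n
    have : s ^ ((n*β+δ)-1) = s ^ (δ-1) * (s^β)^n := by
      rw [← Real.rpow_natCast, ← Real.rpow_mul hs.1.le, ← Real.rpow_add hs.1]; ring_nf
    rw [this, neg_pow (s^β)]; ring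
  · rw [← hR, eML, ML2]; ring

lemma eML_int1 {β δ t : ℝ} (h0 : 0 < β) (h1 : β < 1) (hδ : 0 < δ) (ht : 0 < t) :
    IntervalIntegrable (eML β δ) volume 0 t := by
  refine (eML_int h0 h1 hδ one_pos ht).congr fun s _ => ?_
  simp

lemma eML_prim {β δ t : ℝ} (h0 : 0 < β) (h1 : β < 1) (hδ : 0 < δ) (ht : 0 < t) :
    ∫ s in (0:ℝ)..t, eML β δ s = eML β (δ+1) t := by
  have := eML_conv h0 h1 hδ one_pos ht
  simpa using this

lemma eML_deriv {β δ t : ℝ} (h0 : 0 < β) (h1 : β < 1) (hδ : 0 < δ) (ht : 0 < t) :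
    HasDerivAt (eML β (δ+1)) (eML β δ t) t := by
  have hc : ContinuousOn (eML β δ) (Ioi 0) := fun x hx =>
    (eML_diffAt h0 h1 hδ hx).continuousAt.continuousWithinAt
  have h := intervalIntegral.integral_hasDerivAt_right (eML_int1 h0 h1 hδ ht)
    (hc.stronglyMeasurableAtFilter isOpen_Ioi t ht)
    (eML_diffAt h0 h1 hδ ht).continuousAt
  refine h.congr_of_eventuallyEq ?_
  filter_upwards [Ioi_mem_nhds ht] with x hx
  exact (eML_prim h0 h1 hδ hx).symm

lemma u_deriv {β t : ℝ} (h0 : 0 < β) (h1 : β < 1) (ht : 0 < t) :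
    HasDerivAt (eML β 1) (-(eML β β t)) t := by
  have h := (eML_deriv h0 h1 h0 ht).const_sub 1
  refine h.congr_of_eventuallyEq ?_
  filter_upwards [Ioi_mem_nhds ht] with x hx
  rw [eML_rec h0 h1 one_pos hx, add_comm β 1]
  simp

lemma eML_pos_near {β : ℝ} (h0 : 0 < β) (h1 : β < 1) :
    ∃ ε > 0, ∀ t, 0 < t → t < ε → 0 < eML β β t := by
  have hg := Real.Gamma_pos_of_pos h0
  have hc : Continuous (fun s : ℝ => ML2 β β (-(s^β))) :=
    (ML2_diff h0 h1 h0).continuous.comp (Real.continuous_rpow_const h0.le).neg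
  have hz : 0 < ML2 β β (-((0:ℝ)^β)) := by
    rw [ML2_rec h0 h1 h0, Real.zero_rpow h0.ne']; simp [hg]
  have := (hc.continuousAt (x := 0)).eventually_const_lt hz
  obtain ⟨ε, he, h⟩ := Metric.eventually_nhds_iff.1 this
  refine ⟨ε, he, fun t ht hte => ?_⟩
  have := h (y := t) (by rw [Real.dist_eq, sub_zero, abs_of_pos ht]; exact hte)
  unfold eML
  positivity

lemma f_nonneg {β : ℝ} (h0 : 0 < β) (h1 : β < 1) {t : ℝ} (ht : 0 < t) : 0 ≤ eML β β t := by
  by_contra! hneg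
  obtain ⟨ε, he, hε⟩ := eML_pos_near h0 h1
  have hte : ε ≤ t := by
    by_contra! h
    linarith [hε t ht h]
  obtain ⟨t0, ht0, hmin⟩ := isCompact_Icc.exists_isMinOn (s := Icc ε t) ⟨t, hte, le_rfl⟩
    (f := eML β β) (fun x hx =>
      (eML_diffAt h0 h1 h0 (he.trans_le hx.1)).continuousAt.continuousWithinAt)
  set m := eML β β t0 with hm
  have hm0 : m < 0 := lt_of_le_of_lt (hmin ⟨hte, le_rfl⟩) hneg
  have ht0p : 0 < t0 := he.trans_le ht0.1
  have hge : ∀ s, 0 < s → s ≤ t0 → m ≤ eML β β s := by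
    intro s hs hst
    rcases lt_or_ge s ε with h | h
    · linarith [hε s hs h]
    · exact hmin ⟨h, hst.trans ht0.2⟩
  -- Lipschitz bound at t0
  obtain ⟨L, hL, hLb⟩ := (eML_diffAt h0 h1 h0 ht0p).isBigO_sub.exists_pos
  rw [Asymptotics.IsBigOWith] at hLb
  have hGp := Real.Gamma_pos_of_pos (show 0 < 1 - β by linarith)
  have hGp2 := Real.Gamma_pos_of_pos (show 0 < 2 - β by linarith)
  -- the function G
  let G : ℝ → ℝ := fun x => ∫ s in (0:ℝ)..x, (eML β β s - m) * (x-s)^((1-β)-1)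
  have hki : ∀ x, 0 < x → IntervalIntegrable (fun s : ℝ => (x-s)^((1-β)-1)) volume 0 x := by
    intro x hx
    have := beta_int one_pos (show 0 < 1 - β by linarith) hx
    simpa using this
  have hgi : ∀ x, 0 < x → IntervalIntegrable (fun s : ℝ => (eML β β s - m) * (x-s)^((1-β)-1))
      volume 0 x := by
    intro x hx
    refine ((eML_int h0 h1 h0 (show 0 < 1 - β by linarith) hx).sub ((hki x hx).const_mul m)).congr
      fun s _ => ?_
    ring
  have hG : ∀ x, 0 < x → G x = Real.Gamma (1-β) * (eML β 1 x - m * x^(1-β) / Real.Gamma (2-β)) := by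
    intro x hx
    have e1 := eML_conv h0 h1 h0 (show 0 < 1 - β by linarith) hx
    have e2 := beta_val one_pos (show 0 < 1 - β by linarith) hx
    have e3 : G x = (∫ s in (0:ℝ)..x, eML β β s * (x-s)^((1-β)-1))
        - m * ∫ s in (0:ℝ)..x, (x-s)^((1-β)-1) := by
      rw [← intervalIntegral.integral_const_mul, ← intervalIntegral.integral_sub
        (eML_int h0 h1 h0 (show 0 < 1 - β by linarith) hx) ((hki x hx).const_mul m)]
      refine intervalIntegral.integral_congr fun s _ => ?_
      ring
    simp only [sub_self, Real.rpow_zero, one_mul, Real.Gamma_one] at e2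
    rw [e3, e1, e2]
    rw [show (1:ℝ) + (1-β) - 1 = 1-β by ring, show (1:ℝ) + (1-β) = 2-β by ring,
      show β + (1-β) = 1 by ring]
    ring
  have hGd : HasDerivAt G (Real.Gamma (1-β) *
      (-m - m * ((1-β) * t0^((1-β)-1)) / Real.Gamma (2-β))) t0 := by
    have h := (((u_deriv h0 h1 ht0p).sub (((Real.hasDerivAt_rpow_const (p := 1-β)
      (Or.inl ht0p.ne')).const_mul m).div_const (Real.Gamma (2-β)))).const_mul (Real.Gamma (1-β)))
    refine h.congr_of_eventuallyEq ?_
    filter_upwards [Ioi_mem_nhds ht0p] with x hx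
    rw [hG x hx]; rfl
  set D := Real.Gamma (1-β) * (-m - m * ((1-β) * t0^((1-β)-1)) / Real.Gamma (2-β)) with hD
  have hDp : 0 < D := by
    have : 0 < (-m) * ((1-β) * t0^((1-β)-1)) / Real.Gamma (2-β) := by
      have : 0 < 1 - β := by linarith
      have : 0 < -m := by linarith
      positivity
    apply mul_pos hGp
    have e : -m - m * ((1-β) * t0^((1-β)-1)) / Real.Gamma (2-β) =
      -m + (-m) * ((1-β) * t0^((1-β)-1)) / Real.Gamma (2-β) := by ring
    rw [e]; linarith
  -- slope lower bound
  have hsl : ∀ᶠ x in 𝓝[<] t0, D / 2 < slope G t0 x :=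
    ((hasDerivAt_iff_tendsto_slope.1 hGd).mono_left
      (nhdsWithin_mono _ (fun x (hx : x < t0) => hx.ne))).eventually_const_lt (by linarith)
  -- kernel smallness
  have hsm : ∀ᶠ x in 𝓝[<] t0, L * (t0 - x) ^ (1-β) < D / 2 := by
    have hc : ContinuousAt (fun x => L * (t0 - x) ^ (1-β)) t0 := by
      refine continuousAt_const.mul (ContinuousAt.rpow_const (by fun_prop) (Or.inr (by linarith)))
    have := hc.eventually_lt_const (u := D/2) (by
      simp only [sub_self]; rw [Real.zero_rpow (by linarith)]; linarith)
    exact this.filter_mono nhdsWithin_le_nhds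
  obtain ⟨r, hr, hrb⟩ := Metric.eventually_nhds_iff.1 hLb
  have hnear : ∀ᶠ x in 𝓝[<] t0, t0 - r < x ∧ 0 < x ∧ x < t0 := by
    have a1 : ∀ᶠ x in 𝓝[<] t0, t0 - r < x := 
      (Ioi_mem_nhds (by linarith : t0 - r < t0)) |> mem_nhdsWithin_of_mem_nhds
    have a2 : ∀ᶠ x in 𝓝[<] t0, 0 < x := (Ioi_mem_nhds ht0p) |> mem_nhdsWithin_of_mem_nhds
    filter_upwards [a1, a2, self_mem_nhdsWithin] with x b1 b2 b3
    exact ⟨b1, b2, b3⟩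
  obtain ⟨x, hx1, hx2, hxr, hx0, hxt⟩ := (hsl.and (hsm.and hnear)).exists
  -- upper bound for G t0 - G x
  have hi0 := hgi t0 ht0p
  have hiA : IntervalIntegrable (fun s : ℝ => (eML β β s - m) * (t0-s)^((1-β)-1)) volume 0 x :=
    hi0.mono_set (by rw [uIcc_of_le hx0.le, uIcc_of_le ht0p.le]; exact Icc_subset_Icc_right hxt.le)
  have hiB : IntervalIntegrable (fun s : ℝ => (eML β β s - m) * (t0-s)^((1-β)-1)) volume x t0 :=
    hi0.mono_set (by rw [uIcc_of_le hxt.le, uIcc_of_le ht0p.le]; exact Icc_subset_Icc_left hx0.le)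
  have hsplit : G t0 = (∫ s in (0:ℝ)..x, (eML β β s - m) * (t0-s)^((1-β)-1)) +
      ∫ s in x..t0, (eML β β s - m) * (t0-s)^((1-β)-1) :=
    (intervalIntegral.integral_add_adjacent_intervals hiA hiB).symm
  have hA : (∫ s in (0:ℝ)..x, (eML β β s - m) * (t0-s)^((1-β)-1)) ≤ G x := by
    refine intervalIntegral.integral_mono_on_of_le_Ioo hx0.le hiA (hgi x hx0) fun s hs => ?_
    have := hge s hs.1 (hs.2.le.trans hxt.le)
    refine mul_le_mul_of_nonneg_left ?_ (by linarith)
    exact Real.rpow_le_rpow_of_nonpos (by linarith [hs.2]) (by linarith) (by linarith)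
  have hB : (∫ s in x..t0, (eML β β s - m) * (t0-s)^((1-β)-1)) ≤ 
      ∫ s in x..t0, L * (t0 - x) ^ (1-β) := by
    refine intervalIntegral.integral_mono_on_of_le_Ioo hxt.le hiB (by simp) fun s hs => ?_
    have hp : 0 < t0 - s := by linarith [hs.2]
    have h1' := hrb (y := s) (by rw [Real.dist_eq, abs_lt]; constructor <;> linarith [hs.1])
    have h2' : eML β β s - m ≤ L * (t0 - s) := by
      rw [Real.norm_eq_abs, Real.norm_eq_abs, abs_sub_comm s t0, abs_of_pos hp] at h1'
      exact (le_abs_self _).trans h1'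
    calc _ ≤ L * (t0 - s) * (t0-s)^((1-β)-1) := by gcongr
      _ = L * (t0-s)^(1-β) := by
        rw [mul_assoc]; congr 1
        nth_rw 1 [← Real.rpow_one (t0 - s)]
        rw [← Real.rpow_add hp]; ring_nf
      _ ≤ _ := by
        have : (t0 - s)^(1-β) ≤ (t0-x)^(1-β) :=
          Real.rpow_le_rpow hp.le (by linarith [hs.1]) (by linarith)
        gcongr
  rw [intervalIntegral.integral_const, smul_eq_mul] at hB
  rw [slope_def_field, lt_div_iff_of_neg (by linarith)] at hx1
  have : (t0 - x) * (L * (t0 - x) ^ (1-β)) < (t0 - x) * (D/2) :=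
    mul_lt_mul_of_pos_left hx2 (by linarith)
  nlinarith

lemma u_nonneg {β : ℝ} (h0 : 0 < β) (h1 : β < 1) {t : ℝ} (ht : 0 < t) : 0 ≤ eML β 1 t := by
  have h := eML_conv h0 h1 h0 (show 0 < 1 - β by linarith) ht
  rw [show β + (1-β) = 1 by ring] at h
  have hGp := Real.Gamma_pos_of_pos (show 0 < 1 - β by linarith)
  have : 0 ≤ Real.Gamma (1-β) * eML β 1 t := by
    rw [← h, intervalIntegral.integral_of_le ht.le]
    refine setIntegral_nonneg measurableSet_Ioc fun s hs => ?_
    exact mul_nonneg (f_nonneg h0 h1 hs.1) (Real.rpow_nonneg (by linarith [hs.2]) _)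
  exact nonneg_of_mul_nonneg_right this hGp

lemma u_anti {β : ℝ} (h0 : 0 < β) (h1 : β < 1) {a b : ℝ} (ha : 0 < a) (hab : a ≤ b) :
    eML β 1 b ≤ eML β 1 a := by
  rcases hab.eq_or_lt with rfl | hab
  · exact le_rfl
  obtain ⟨c, hc, he⟩ := exists_hasDerivAt_eq_slope (eML β 1) (fun t => -(eML β β t)) hab
    (fun x hx => (u_deriv h0 h1 (ha.trans_le hx.1)).continuousAt.continuousWithinAt)
    (fun x hx => u_deriv h0 h1 (ha.trans hx.1))
  have := f_nonneg h0 h1 (ha.trans hc.1)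
  rw [eq_div_iff (by linarith)] at he
  nlinarith

lemma V_mvt {β : ℝ} (h0 : 0 < β) (h1 : β < 1) {a b : ℝ} (ha : 0 < a) (hab : a < b) :
    eML β 1 b * (b - a) ≤ eML β 2 b - eML β 2 a ∧ 
    eML β 2 b - eML β 2 a ≤ eML β 1 a * (b - a) := by
  have hd : ∀ x, 0 < x → HasDerivAt (eML β 2) (eML β 1 x) x := fun x hx => by
    have := eML_deriv h0 h1 one_pos hx
    rwa [one_add_one_eq_two] at this
  obtain ⟨c, hc, he⟩ := exists_hasDerivAt_eq_slope (eML β 2) (eML β 1) hab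
    (fun x hx => (hd x (ha.trans_le hx.1)).continuousAt.continuousWithinAt)
    (fun x hx => hd x (ha.trans hx.1))
  rw [eq_div_iff (by linarith)] at he
  have := u_anti h0 h1 ha hc.1.le
  have := u_anti h0 h1 (ha.trans hc.1) hc.2.le
  constructor <;> nlinarith

lemma V_eq {β : ℝ} (h0 : 0 < β) (h1 : β < 1) {t : ℝ} (ht : 0 < t) :
    eML β 2 t = t^(1-β) / Real.Gamma (2-β) - eML β (2-β) t := by
  have := eML_rec (δ := 2-β) h0 h1 (by linarith) ht
  rw [show 2-β-1 = 1-β by ring, show 2-β+β = 2 by ring] at this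
  linarith

lemma w_nonneg {β : ℝ} (h0 : 0 < β) (h1 : β < 1) {t : ℝ} (ht : 0 < t) : 0 ≤ eML β (2-β) t := by
  have h := eML_conv h0 h1 one_pos (show 0 < 1 - β by linarith) ht
  rw [show 1 + (1-β) = 2-β by ring] at h
  have hGp := Real.Gamma_pos_of_pos (show 0 < 1 - β by linarith)
  have : 0 ≤ Real.Gamma (1-β) * eML β (2-β) t := by
    rw [← h, intervalIntegral.integral_of_le ht.le]
    refine setIntegral_nonneg measurableSet_Ioc fun s hs => ?_
    exact mul_nonneg (u_nonneg h0 h1 hs.1) (Real.rpow_nonneg (by linarith [hs.2]) _)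
  exact nonneg_of_mul_nonneg_right this hGp

lemma u_le {β : ℝ} (h0 : 0 < β) (h1 : β < 1) {t : ℝ} (ht : 0 < t) :
    eML β 1 t ≤ (1 / Real.Gamma (2-β)) * t^((1-β)-1) := by
  have hV : eML β 1 t * t ≤ eML β 2 t := by
    have h := eML_prim h0 h1 one_pos ht
    rw [one_add_one_eq_two] at h
    rw [← h]
    have h2 : ∫ s in (0:ℝ)..t, eML β 1 t ≤ ∫ s in (0:ℝ)..t, eML β 1 s :=
      intervalIntegral.integral_mono_on_of_le_Ioo ht.le (by simp) (eML_int1 h0 h1 one_pos ht)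
        fun s hs => u_anti h0 h1 hs.1 hs.2.le
    simp only [intervalIntegral.integral_const, smul_eq_mul, sub_zero] at h2
    linarith
  have h3 := V_eq h0 h1 ht
  have h4 := w_nonneg h0 h1 ht
  rw [Real.rpow_sub_one ht.ne', ← mul_div_assoc, le_div_iff₀ ht]
  calc _ ≤ _ := hV
    _ ≤ _ := by rw [h3, one_div_mul_eq_div]; linarith

lemma w_le {β : ℝ} (h0 : 0 < β) (h1 : β < 1) : ∃ C : ℝ, ∀ t : ℝ, 0 < t →
    eML β (2-β) t ≤ C * t^(1-2*β) := by
  have hb : 0 < 1 - β := by linarith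
  have hGp := Real.Gamma_pos_of_pos hb
  refine ⟨(1 / Real.Gamma (2-β)) * (Real.Gamma (1-β) * Real.Gamma (1-β) / 
    Real.Gamma ((1-β)+(1-β))) / Real.Gamma (1-β), fun t ht => ?_⟩
  have h := eML_conv h0 h1 one_pos hb ht
  rw [show 1 + (1-β) = 2-β by ring] at h
  have h2 : ∫ s in (0:ℝ)..t, eML β 1 s * (t-s)^((1-β)-1) ≤ ∫ s in (0:ℝ)..t,
      (1 / Real.Gamma (2-β)) * (s^((1-β)-1) * (t-s)^((1-β)-1)) := by
    refine intervalIntegral.integral_mono_on_of_le_Ioo ht.le (eML_int h0 h1 one_pos hb ht)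
      ((beta_int hb hb ht).const_mul _) fun s hs => ?_
    rw [← mul_assoc]
    exact mul_le_mul_of_nonneg_right (u_le h0 h1 hs.1) (Real.rpow_nonneg (by linarith [hs.2]) _)
  rw [h, intervalIntegral.integral_const_mul, beta_val hb hb ht,
    show (1-β)+(1-β)-1 = 1-2*β by ring] at h2
  rw [← le_div_iff₀' hGp] at h2
  refine h2.trans_eq ?_
  ring

lemma V_lim {β : ℝ} (h0 : 0 < β) (h1 : β < 1) :
    Tendsto (fun t => t^(β-1) * eML β 2 t) atTop (𝓝 (1 / Real.Gamma (2-β))) := by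
  obtain ⟨C, hC⟩ := w_le h0 h1
  have hz : Tendsto (fun t : ℝ => t^(β-1) * eML β (2-β) t) atTop (𝓝 0) := by
    have h := (tendsto_rpow_neg_atTop h0).const_mul C
    rw [mul_zero] at h
    refine tendsto_of_tendsto_of_tendsto_of_le_of_le' tendsto_const_nhds h ?_ ?_
    · filter_upwards [eventually_gt_atTop 0] with t ht
      exact mul_nonneg (Real.rpow_nonneg ht.le _) (w_nonneg h0 h1 ht)
    · filter_upwards [eventually_gt_atTop 0] with t ht
      calc _ ≤ t^(β-1) * (C * t^(1-2*β)) := by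
            exact mul_le_mul_of_nonneg_left (hC t ht) (Real.rpow_nonneg ht.le _)
        _ = C * (t^(β-1) * t^(1-2*β)) := by ring
        _ = _ := by rw [← Real.rpow_add ht]; ring_nf
  have h := hz.const_sub (1 / Real.Gamma (2-β))
  rw [sub_zero] at h
  refine h.congr' ?_
  filter_upwards [eventually_gt_atTop 0] with t ht
  rw [V_eq h0 h1 ht, mul_sub, ← mul_div_assoc, ← Real.rpow_add ht]
  simp

lemma V_lim_scale {β l : ℝ} (h0 : 0 < β) (h1 : β < 1) (hl : 0 < l) :
    Tendsto (fun t => t^(β-1) * (eML β 2 (l * t) - eML β 2 t) / (l - 1)) atTop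
      (𝓝 ((l^(1-β) - 1) / (l - 1) * (1 / Real.Gamma (2-β)))) := by
  have hV := V_lim h0 h1
  have h2 := (hV.comp (tendsto_id.const_mul_atTop hl)).const_mul (l^(1-β))
  have h3 := (h2.sub hV).div_const (l-1)
  have e : (l^(1-β) - 1) / (l - 1) * (1 / Real.Gamma (2-β)) =
    (l^(1-β) * (1 / Real.Gamma (2-β)) - 1 / Real.Gamma (2-β)) / (l-1) := by ring
  rw [e]
  refine h3.congr' ?_
  filter_upwards [eventually_gt_atTop 0] with t ht
  simp only [Function.comp, id]
  rw [Real.mul_rpow hl.le ht.le]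
  have : l^(1-β) * l^(β-1) = 1 := by rw [← Real.rpow_add hl]; simp
  linear_combination (t^(β-1) * eML β 2 (l*t) / (l-1)) * this

lemma slope_lim {β : ℝ} (h1 : β < 1) :
    Tendsto (fun l : ℝ => (l^(1-β) - 1) / (l - 1) * (1 / Real.Gamma (2-β))) (𝓝[≠] 1)
      (𝓝 (1 / Real.Gamma (1-β))) := by
  have h := Real.hasDerivAt_rpow_const (x := 1) (p := 1-β) (Or.inl one_ne_zero)
  have h2 := (hasDerivAt_iff_tendsto_slope.1 h).mul_const (1 / Real.Gamma (2-β))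
  have hb : 0 < 1 - β := by linarith
  have hG : Real.Gamma (2-β) = (1-β) * Real.Gamma (1-β) := by
    rw [← Real.Gamma_add_one hb.ne']; ring_nf
  have hGp := Real.Gamma_pos_of_pos hb
  have e : (1-β) * 1^((1-β)-1) * (1 / Real.Gamma (2-β)) = 1 / Real.Gamma (1-β) := by
    rw [hG, Real.one_rpow]; field_simp
  rw [e] at h2
  refine h2.congr fun l => ?_
  rw [slope_def_field, Real.one_rpow]

/-- For `β ∈ (0,1)`, the Mittag-Leffler survival function decays as a power law:
`t^β E_β(-t^β) → 1/Γ(1-β)` as `t → ∞`. -/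
theorem mittagLeffler_survival_powerlaw (β : ℝ) (hβ : β ∈ Set.Ioo (0:ℝ) 1) :
    Filter.Tendsto (fun t : ℝ => t ^ β * ML β (-(t ^ β))) Filter.atTop
      (nhds (1 / Real.Gamma (1 - β))) := by
  obtain ⟨h0, h1⟩ := hβ
  have hu : ∀ t, ML β (-(t^β)) = eML β 1 t := fun t => by simp [ML, eML]
  simp_rw [hu]
  have key : ∀ t : ℝ, 0 < t → t^β * eML β 1 t = t^(β-1) * (eML β 1 t * t) := fun t ht => by
    rw [Real.rpow_sub_one ht.ne']; field_simp
  refine tendsto_order.2 ⟨fun a ha => ?_, fun a ha => ?_⟩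
  · have h := ((slope_lim h1).mono_left (nhdsWithin_mono (s := Ioi 1) _
      (fun x (hx : 1 < x) => hx.ne'))).eventually_const_lt ha
    obtain ⟨l, hl, hl1⟩ := (h.and self_mem_nhdsWithin).exists
    have hl1 : 1 < l := hl1
    filter_upwards [(V_lim_scale h0 h1 (by linarith : 0 < l)).eventually_const_lt hl,
      eventually_gt_atTop 0] with t hta ht
    refine hta.trans_le ?_
    have hm := (V_mvt h0 h1 ht (b := l * t) (by nlinarith)).2
    rw [key t ht, div_le_iff₀ (by linarith), mul_assoc]
    refine mul_le_mul_of_nonneg_left ?_ (Real.rpow_nonneg ht.le _)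
    linarith
  · have h := ((slope_lim h1).mono_left (nhdsWithin_mono (s := Iio 1) _
      (fun x (hx : x < 1) => hx.ne))).eventually_lt_const ha
    have h' : ∀ᶠ l : ℝ in 𝓝[<] 1, 0 < l := mem_nhdsWithin_of_mem_nhds (Ioi_mem_nhds one_pos)
    obtain ⟨l, hl, hl0, hl1⟩ := (h.and (h'.and self_mem_nhdsWithin)).exists
    have hl1 : l < 1 := hl1
    filter_upwards [(V_lim_scale h0 h1 hl0).eventually_lt_const hl,
      eventually_gt_atTop 0] with t hta ht
    refine lt_of_le_of_lt ?_ hta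
    have hm := (V_mvt h0 h1 (a := l * t) (b := t) (by positivity) (by nlinarith)).1
    rw [key t ht, le_div_iff_of_neg (by linarith), mul_assoc]
    refine mul_le_mul_of_nonneg_left ?_ (Real.rpow_nonneg ht.le _)
    linarith
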